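/- arXiv:0709.4515 — 2 statements merged into one kernel-verified Lean document; each statement's English description precedes it below -/
import Mathlib

section
/- Let K be a field of characteristic 2 and let (V,T) be a non-degenerate indecomposable form module over K. Then there exist v₁, v₂ ∈ V such that V is the direct sum of the K[T]-submodules generated by v₁ and by v₂ (i.e. V = span{T^i v₁} ⊕ span{T^i v₂} as vector spaces), and, writing m = μ(v₁), m′ = μ(v₂) with m ≥ m′, one of the following holds: (i) m′ = m and ⟨T^{m−1}v₁, v₂⟩ ≠ 0; or (ii) m′ = m−1, Q(T^{m−1}v₁) ≠ 0, ⟨T^{m−1}v₁, v₂⟩ = 0, and ⟨T^{m−2}v₁, v₂⟩ ≠ 0 whenever m ≥ 2. -/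
open Module Finset

/-- The radical `V^⊥ = {v | ⟨v,w⟩ = 0 for all w}` of the polar form of `Q`. -/
def QuadraticForm.polarRadical {F V : Type*} [Field F] [AddCommGroup V] [Module F V]
    (Q : QuadraticForm F V) : Submodule F V :=
  LinearMap.ker (QuadraticMap.polarBilin Q)

/-- A quadratic space `(V, Q)` (in characteristic 2) is non-degenerate if `V ≠ 0`,
`dim V^⊥ ≤ 1` and `Q(v) ≠ 0` for every nonzero `v ∈ V^⊥`. -/
def QuadraticForm.IsNondegenerateFormSpace {F V : Type*} [Field F] [AddCommGroup V] [Module F V]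
    (Q : QuadraticForm F V) : Prop :=
  Nontrivial V ∧ Module.finrank F Q.polarRadical ≤ 1 ∧
    ∀ v ∈ Q.polarRadical, v ≠ 0 → Q v ≠ 0

/-- Membership in the orthogonal Lie algebra
`𝔬(V) = {x ∈ End(V) | ⟨xv, v⟩ = 0 ∀ v, tr x = 0}`. -/
def QuadraticForm.mem_oLie {F V : Type*} [Field F] [AddCommGroup V] [Module F V]
    (Q : QuadraticForm F V) (x : Module.End F V) : Prop :=
  (∀ v : V, QuadraticMap.polar Q (x v) v = 0) ∧ LinearMap.trace F V x = 0


/-- A form module `(V, T)` (with `V` a non-degenerate quadratic space and `T` a nilpotent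
element of `𝔬(V)`) is indecomposable if for every orthogonal decomposition
`V = V₁ ⊕ V₂` into `T`-invariant subspaces, `V₁ = 0` or `V₂ = 0`. -/
def QuadraticForm.FormModuleIndecomposable {F V : Type*} [Field F] [AddCommGroup V]
    [Module F V] (Q : QuadraticForm F V) (T : Module.End F V) : Prop :=
  ∀ V₁ V₂ : Submodule F V,
    (∀ v ∈ V₁, T v ∈ V₁) → (∀ v ∈ V₂, T v ∈ V₂) →
    V₁ ⊓ V₂ = ⊥ → V₁ ⊔ V₂ = ⊤ →
    (∀ v₁ ∈ V₁, ∀ v₂ ∈ V₂, QuadraticMap.polar Q v₁ v₂ = 0) →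
    V₁ = ⊥ ∨ V₂ = ⊥

/-- `μ(v) = min {k ≥ 0 | T^k v = 0}`. -/
noncomputable def nilpOrder {F V : Type*} [Field F] [AddCommGroup V] [Module F V]
    (T : Module.End F V) (v : V) : ℕ :=
  sInf {k : ℕ | (T ^ k) v = 0}

namespace FormModuleAux

variable {K V : Type*} [Field K] [AddCommGroup V] [Module K V]

/-- The cyclic submodule generated by `x`. -/
def cyc (T : Module.End K V) (x : V) : Submodule K V :=
  Submodule.span K (Set.range fun i : ℕ => (T ^ i) x)

theorem pow_mem_cyc (T : Module.End K V) (x : V) (i : ℕ) : (T ^ i) x ∈ cyc T x :=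
  Submodule.subset_span ⟨i, rfl⟩

theorem self_mem_cyc (T : Module.End K V) (x : V) : x ∈ cyc T x := by
  simpa using pow_mem_cyc T x 0

theorem cyc_induct (T : Module.End K V) (x : V) (N : Submodule K V)
    (h : ∀ i, (T ^ i) x ∈ N) : cyc T x ≤ N := by
  apply Submodule.span_le.2
  rintro _ ⟨i, rfl⟩
  exact h i

theorem pow_app (T : Module.End K V) (i j : ℕ) (x : V) : (T ^ i) ((T ^ j) x) = (T ^ (i + j)) x := by
  rw [pow_add]; rfl

theorem pow_app_one (T : Module.End K V) (i : ℕ) (x : V) : (T ^ i) (T x) = (T ^ (i + 1)) x := by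
  rw [pow_succ]; rfl

theorem app_pow (T : Module.End K V) (i : ℕ) (x : V) : T ((T ^ i) x) = (T ^ (i + 1)) x := by
  rw [pow_succ']; rfl

theorem inv_pow {T : Module.End K V} {N : Submodule K V} (h : ∀ v ∈ N, T v ∈ N) (i : ℕ) :
    ∀ v ∈ N, (T ^ i) v ∈ N := by
  induction i with
  | zero => intro v hv; simpa using hv
  | succ i ih => intro v hv; rw [← pow_app_one]; exact ih _ (h v hv)

theorem cyc_inv (T : Module.End K V) (x : V) : ∀ v ∈ cyc T x, T v ∈ cyc T x := by
  intro v hv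
  have : cyc T x ≤ (cyc T x).comap T := by
    apply cyc_induct
    intro i
    rw [Submodule.mem_comap, app_pow]
    exact pow_mem_cyc _ _ _
  exact this hv

theorem cyc_le {T : Module.End K V} {N : Submodule K V} (h : ∀ v ∈ N, T v ∈ N) {x : V}
    (hx : x ∈ N) : cyc T x ≤ N := cyc_induct T x N fun i => inv_pow h i x hx

theorem nilp_eq (T : Module.End K V) (x : V) (k : ℕ) (h0 : (T ^ (k + 1)) x = 0)
    (h1 : (T ^ k) x ≠ 0) : nilpOrder T x = k + 1 := by
  unfold nilpOrder
  apply le_antisymm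
  · exact Nat.sInf_le h0
  · have hm : (T ^ sInf {k : ℕ | (T ^ k) x = 0}) x = 0 := Nat.sInf_mem (s := {k : ℕ | (T ^ k) x = 0}) ⟨k + 1, h0⟩
    by_contra hlt
    push Not at hlt
    apply h1
    obtain ⟨d, hd⟩ := Nat.exists_eq_add_of_le (Nat.lt_succ_iff.1 hlt)
    rw [hd, add_comm, ← pow_app, hm, map_zero]

theorem exists_sub (T : Module.End K V) (x : V) (g : V →ₗ[K] K) (k : ℕ)
    (h1 : g ((T ^ k) x) ≠ 0) (h0 : ∀ i, k < i → g ((T ^ i) x) = 0) (v : V) :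
    ∃ a ∈ cyc T x, ∀ i, i ≤ k → g ((T ^ i) (v - a)) = 0 := by
  have key : ∀ j, j ≤ k + 1 → ∃ a ∈ cyc T x, ∀ i, i ≤ k → k + 1 ≤ i + j → g ((T ^ i) (v - a)) = 0 := by
    intro j
    induction j with
    | zero => intro _; exact ⟨0, zero_mem _, fun i h h' => by omega⟩
    | succ j ih =>
      intro hj
      obtain ⟨a, ha, hga⟩ := ih (by omega)
      refine ⟨a + (g ((T ^ (k - j)) (v - a)) / g ((T ^ k) x)) • (T ^ j) x,
        add_mem ha (Submodule.smul_mem _ _ (pow_mem_cyc _ _ _)), ?_⟩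
      intro i hi hij
      rw [← sub_sub, map_sub, map_sub, map_smul, map_smul, pow_app]
      by_cases h : k + 1 ≤ i + j
      · rw [hga i hi h, h0 (i + j) (by omega)]; simp
      · have e1 : i = k - j := by omega
        have e2 : i + j = k := by omega
        rw [e2, ← e1, smul_eq_mul, div_mul_cancel₀ _ h1, sub_self]
  obtain ⟨a, ha, h⟩ := key (k + 1) le_rfl
  exact ⟨a, ha, fun i hi => h i hi (by omega)⟩

theorem cyc_split (T : Module.End K V) (x a : V) (ha : a ∈ cyc T x) :
    ∃ c : K, ∃ b ∈ cyc T (T x), a = c • x + b := by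
  have : cyc T x ≤ Submodule.span K {x} ⊔ cyc T (T x) := by
    apply cyc_induct
    intro i
    cases i with
    | zero => exact Submodule.mem_sup_left (by simp)
    | succ i =>
      rw [← pow_app_one]
      exact Submodule.mem_sup_right (pow_mem_cyc _ _ _)
  obtain ⟨y, hy, b, hb, rfl⟩ := Submodule.mem_sup.1 (this ha)
  obtain ⟨c, rfl⟩ := Submodule.mem_span_singleton.1 hy
  exact ⟨c, b, hb, rfl⟩

theorem cyc_kill (T : Module.End K V) (x : V) (k : ℕ) (h : (T ^ k) x = 0) :
    ∀ b ∈ cyc T x, (T ^ k) b = 0 := by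
  intro b hb
  have : cyc T x ≤ LinearMap.ker (T ^ k) := by
    apply cyc_induct
    intro i
    rw [LinearMap.mem_ker, pow_app, add_comm, ← pow_app, h, map_zero]
  exact this hb

theorem cyc_eq_zero (T : Module.End K V) (g : V →ₗ[K] K) (k : ℕ) :
    ∀ (x : V) (_ : g ((T ^ k) x) ≠ 0) (_ : (T ^ (k + 1)) x = 0) (a : V) (_ : a ∈ cyc T x)
    (_ : ∀ i, g ((T ^ i) a) = 0), a = 0 := by
  induction k with
  | zero =>
    intro x h1 h0 a ha hg
    obtain ⟨c, b, hb, rfl⟩ := cyc_split T x a ha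
    have hb0 : (T ^ 0) b = 0 := cyc_kill T (T x) 0 (by simpa using h0) b hb
    have := hg 0
    rw [map_add, hb0, add_zero, map_smul, map_smul, smul_eq_mul] at this
    have hc := (mul_eq_zero.1 this).resolve_right h1
    simp only [pow_zero, Module.End.one_apply] at hb0
    simp [hc, hb0]
  | succ k ih =>
    intro x h1 h0 a ha hg
    obtain ⟨c, b, hb, rfl⟩ := cyc_split T x a ha
    have hb0 : (T ^ (k + 1)) b = 0 := cyc_kill T (T x) (k + 1) (by rw [pow_app_one]; exact h0) b hb
    have := hg (k + 1)
    rw [map_add, hb0, add_zero, map_smul, map_smul, smul_eq_mul] at this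
    have hc := (mul_eq_zero.1 this).resolve_right h1
    subst hc
    rw [zero_smul, zero_add] at hg ⊢
    exact ih (T x) (by rwa [pow_app_one]) (by rwa [pow_app_one]) b hb hg

theorem adj_pow {T : Module.End K V} {B : LinearMap.BilinForm K V}
    (h : ∀ v w, B (T v) w = B v (T w)) (i : ℕ) : ∀ v w, B ((T ^ i) v) w = B v ((T ^ i) w) := by
  induction i with
  | zero => intro v w; simp
  | succ i ih => intro v w; rw [← app_pow, h, ih, pow_app_one]

theorem iso_pow {T : Module.End K V} {B : LinearMap.BilinForm K V}
    (h : ∀ v w, B (T v) w = B v (T w)) (h0 : ∀ v, B v v = 0) (h1 : ∀ v, B (T v) v = 0)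
    (i : ℕ) (v : V) : B ((T ^ i) v) v = 0 := by
  obtain ⟨j, hj | hj⟩ := Nat.even_or_odd' i
  · rw [hj, two_mul, ← pow_app, adj_pow h, h0]
  · rw [show i = j + (j + 1) by omega, ← pow_app, adj_pow h, ← app_pow, h1]

/-- orthogonality to `x`, hence to the cyclic module -/
theorem orth_cyc {T : Module.End K V} {B : LinearMap.BilinForm K V}
    (h : ∀ v w, B (T v) w = B v (T w)) {x y : V} (hy : ∀ i, B ((T ^ i) y) x = 0) :
    ∀ a ∈ cyc T x, B y a = 0 := by
  intro a ha
  have : cyc T x ≤ LinearMap.ker (B y) := by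
    apply cyc_induct
    intro i
    rw [LinearMap.mem_ker, ← adj_pow h]
    exact hy i
  exact this ha

theorem iso_cyc {T : Module.End K V} {B : LinearMap.BilinForm K V}
    (h : ∀ v w, B (T v) w = B v (T w)) (h0 : ∀ v, B v v = 0) (h1 : ∀ v, B (T v) v = 0)
    (x : V) : ∀ a ∈ cyc T x, ∀ b ∈ cyc T x, B a b = 0 := by
  intro a ha b hb
  refine orth_cyc h (fun i => ?_) b hb
  have : cyc T x ≤ LinearMap.ker (B.flip x ∘ₗ (T ^ i)) := by
    apply cyc_induct
    intro j
    rw [LinearMap.mem_ker, LinearMap.comp_apply, pow_app]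
    change B ((T ^ (i + j)) x) x = 0
    exact iso_pow h h0 h1 _ _
  exact this ha

end FormModuleAux

open FormModuleAux

/-- Structure of non-degenerate indecomposable form modules over a field of
characteristic 2 (Hesselink): `V = A v₁ ⊕ A v₂` with either (i) `μ(v₂) = μ(v₁) = m` and
`⟨T^{m-1} v₁, v₂⟩ ≠ 0`, or (ii) `μ(v₂) = m - 1`, `Q(T^{m-1} v₁) ≠ 0`,
`⟨T^{m-1} v₁, v₂⟩ = 0` and `⟨T^{m-2} v₁, v₂⟩ ≠ 0` whenever `m ≥ 2`. -/
theorem indecomposable_form_module_structure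
    (K : Type*) [Field K] [CharP K 2]
    (V : Type*) [AddCommGroup V] [Module K V] [FiniteDimensional K V]
    (Q : QuadraticForm K V) (T : Module.End K V)
    (hQ : Q.IsNondegenerateFormSpace) (hT : Q.mem_oLie T) (hTnil : IsNilpotent T)
    (hind : Q.FormModuleIndecomposable T) :
    ∃ v₁ v₂ : V,
      Submodule.span K (Set.range fun i : ℕ => (T ^ i) v₁) ⊓
        Submodule.span K (Set.range fun i : ℕ => (T ^ i) v₂) = ⊥ ∧
      Submodule.span K (Set.range fun i : ℕ => (T ^ i) v₁) ⊔
        Submodule.span K (Set.range fun i : ℕ => (T ^ i) v₂) = ⊤ ∧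
      nilpOrder T v₂ ≤ nilpOrder T v₁ ∧
      ((nilpOrder T v₂ = nilpOrder T v₁ ∧
          QuadraticMap.polar Q ((T ^ (nilpOrder T v₁ - 1)) v₁) v₂ ≠ 0) ∨
       (nilpOrder T v₂ = nilpOrder T v₁ - 1 ∧
          Q ((T ^ (nilpOrder T v₁ - 1)) v₁) ≠ 0 ∧
          QuadraticMap.polar Q ((T ^ (nilpOrder T v₁ - 1)) v₁) v₂ = 0 ∧
          (2 ≤ nilpOrder T v₁ →
            QuadraticMap.polar Q ((T ^ (nilpOrder T v₁ - 2)) v₁) v₂ ≠ 0))) := by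
  change ∃ v₁ v₂ : V, cyc T v₁ ⊓ cyc T v₂ = ⊥ ∧ cyc T v₁ ⊔ cyc T v₂ = ⊤ ∧ _
  obtain ⟨hnt, hrk, hQR⟩ := hQ
  obtain ⟨hT1, -⟩ := hT
  have h2 : (2 : K) = 0 := CharTwo.two_eq_zero
  set B : LinearMap.BilinForm K V := QuadraticMap.polarBilin Q with hB
  have hBp : ∀ x y, QuadraticMap.polar Q x y = B x y := fun x y => rfl
  simp only [hBp] at hT1 ⊢
  have hsymm : ∀ x y, B x y = B y x := fun x y => QuadraticMap.polar_comm Q x y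
  have halt : ∀ x, B x x = 0 := by
    intro x
    rw [← hBp, QuadraticMap.polar_self, two_nsmul, ← two_mul, h2, zero_mul]
  have hadj : ∀ v w, B (T v) w = B v (T w) := by
    intro v w
    have := hT1 (v + w)
    rw [map_add, map_add, map_add, LinearMap.add_apply, LinearMap.add_apply, hT1, hT1, zero_add,
      add_zero, hsymm (T w) v, add_comm] at this
    exact CharTwo.add_eq_zero.1 this
  have hR : ∀ r, r ∈ Q.polarRadical ↔ ∀ w, B r w = 0 := by
    intro r
    unfold QuadraticForm.polarRadical
    rw [LinearMap.mem_ker]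
    exact ⟨fun h w => by rw [hB, h]; rfl, fun h => LinearMap.ext h⟩
  have hiso := iso_cyc hadj halt hT1
  have hrefl : B.IsRefl := fun x y h => by rw [hsymm]; exact h
  -- nilpotency class
  obtain ⟨k, hk0, x₀, hk1⟩ : ∃ k, (∀ v, (T ^ (k + 1)) v = 0) ∧ ∃ v, (T ^ k) v ≠ 0 := by
    have hpos := (pos_nilpotencyClass_iff).2 hTnil
    refine ⟨nilpotencyClass T - 1, ?_, ?_⟩
    · intro v
      rw [Nat.sub_add_cancel hpos, pow_nilpotencyClass hTnil]; rfl
    · by_contra hc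
      push Not at hc
      exact pow_pred_nilpotencyClass hTnil (LinearMap.ext hc)
  have hkge : ∀ i, k < i → ∀ v, (T ^ i) v = 0 := by
    intro i hi v
    obtain ⟨d, rfl⟩ := Nat.exists_eq_add_of_le (Nat.succ_le_of_lt hi)
    rw [Nat.succ_eq_add_one, add_comm, ← pow_app, hk0, map_zero]
  by_cases hcase : ∃ v w, B ((T ^ k) v) w ≠ 0
  · obtain ⟨v₁, v₂, hvv⟩ := hcase
    have hvv' : B ((T ^ k) v₂) v₁ ≠ 0 := by rwa [adj_pow hadj, hsymm]
    have n1 : nilpOrder T v₁ = k + 1 := nilp_eq T v₁ k (hk0 _) (fun h => hvv (by simp [h]))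
    have n2 : nilpOrder T v₂ = k + 1 := nilp_eq T v₂ k (hk0 _) (fun h => hvv' (by simp [h]))
    set W := cyc T v₁ ⊔ cyc T v₂ with hW
    have z1 : ∀ a ∈ cyc T v₁, (∀ i, B ((T ^ i) a) v₂ = 0) → a = 0 := fun a ha h =>
      cyc_eq_zero T (B.flip v₂) k v₁ hvv (hk0 _) a ha h
    have z2 : ∀ a ∈ cyc T v₂, (∀ i, B ((T ^ i) a) v₁ = 0) → a = 0 := fun a ha h =>
      cyc_eq_zero T (B.flip v₁) k v₂ hvv' (hk0 _) a ha h
    have i1 : ∀ a ∈ cyc T v₁, ∀ i, B ((T ^ i) a) v₁ = 0 := fun a ha i =>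
      hiso v₁ _ (inv_pow (cyc_inv T v₁) i a ha) _ (self_mem_cyc _ _)
    have i2 : ∀ a ∈ cyc T v₂, ∀ i, B ((T ^ i) a) v₂ = 0 := fun a ha i =>
      hiso v₂ _ (inv_pow (cyc_inv T v₂) i a ha) _ (self_mem_cyc _ _)
    let U : Submodule K V := 
      { carrier := {v | ∀ i, B ((T ^ i) v) v₁ = 0 ∧ B ((T ^ i) v) v₂ = 0}
        add_mem' := by
          intro a b ha hb i
          simp [(ha i).1, (ha i).2, (hb i).1, (hb i).2]
        zero_mem' := by intro i; simp
        smul_mem' := by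
          intro c a ha i
          simp [(ha i).1, (ha i).2] }
    have hUmem : ∀ v, v ∈ U ↔ ∀ i, B ((T ^ i) v) v₁ = 0 ∧ B ((T ^ i) v) v₂ = 0 := fun v => Iff.rfl
    have hWU : W ⊓ U = ⊥ := by
      rw [eq_bot_iff]
      rintro w ⟨hw, hu⟩
      obtain ⟨a, ha, b, hb, rfl⟩ := Submodule.mem_sup.1 hw
      have ea : a = 0 := z1 a ha fun i => by
        have := (hu i).2
        rwa [map_add, map_add, LinearMap.add_apply, i2 b hb, add_zero] at this
      have eb : b = 0 := z2 b hb fun i => by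
        have := (hu i).1
        rwa [map_add, map_add, LinearMap.add_apply, i1 a ha, zero_add] at this
      simp [ea, eb]
    have hWUt : W ⊔ U = ⊤ := by
      rw [eq_top_iff]
      rintro v -
      obtain ⟨a, ha, hga⟩ := exists_sub T v₁ (B.flip v₂) k hvv (fun i hi => by simp [hkge i hi]) v
      obtain ⟨b, hb, hgb⟩ := exists_sub T v₂ (B.flip v₁) k hvv' (fun i hi => by simp [hkge i hi]) v
      refine Submodule.mem_sup.2 ⟨a + b, Submodule.add_mem_sup ha hb, v - (a + b), ?_, by abel⟩
      intro i
      rcases le_or_gt i k with hi | hi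
      · constructor
        · have e : v - (a + b) = (v - b) - a := by abel
          have : B ((T ^ i) (v - b)) v₁ = 0 := hgb i hi
          rw [e, map_sub, map_sub, LinearMap.sub_apply, i1 a ha, this, sub_zero]
        · have e : v - (a + b) = (v - a) - b := by abel
          have : B ((T ^ i) (v - a)) v₂ = 0 := hga i hi
          rw [e, map_sub, map_sub, LinearMap.sub_apply, i2 b hb, this, sub_zero]
      · simp [hkge i hi]
    have hWinv : ∀ v ∈ W, T v ∈ W := by
      intro v hv
      obtain ⟨a, ha, b, hb, rfl⟩ := Submodule.mem_sup.1 hv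
      rw [map_add]
      exact Submodule.add_mem_sup (cyc_inv T _ a ha) (cyc_inv T _ b hb)
    have hUinv : ∀ v ∈ U, T v ∈ U := by
      intro v hv i
      rw [pow_app_one]
      exact hv (i + 1)
    have horth : ∀ w ∈ W, ∀ u ∈ U, QuadraticMap.polar Q w u = 0 := by
      intro w hw u hu
      obtain ⟨a, ha, b, hb, rfl⟩ := Submodule.mem_sup.1 hw
      rw [hBp, hsymm, map_add, orth_cyc hadj (fun i => (hu i).1) a ha,
        orth_cyc hadj (fun i => (hu i).2) b hb, add_zero]
    refine ⟨v₁, v₂, ?_, ?_, ?_, Or.inl ⟨?_, ?_⟩⟩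
    · rw [eq_bot_iff]
      rintro a ⟨ha, hb⟩
      exact z1 a ha (i2 a hb)
    · rcases hind W U hWinv hUinv hWU hWUt horth with h | h
      · exfalso
        have : v₁ ∈ W := Submodule.mem_sup_left (self_mem_cyc _ _)
        rw [h, Submodule.mem_bot] at this
        exact hvv (by simp [this])
      · rw [h, sup_bot_eq] at hWUt
        exact hWUt
    · rw [n1, n2]
    · rw [n1, n2]
    · rw [n1]; exact hvv
  · push Not at hcase
    set r := (T ^ k) x₀ with hr
    have hrR : r ∈ Q.polarRadical := (hR r).2 (hcase x₀)
    have hRspan : ∀ s, (∀ w, B s w = 0) → ∃ c : K, c • r = s := by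
      intro s hs
      have h1 : Module.finrank K Q.polarRadical = 1 := by
        refine le_antisymm hrk ?_
        have : Nontrivial Q.polarRadical := ⟨⟨r, hrR⟩, 0, fun h => hk1 (congrArg Subtype.val h)⟩
        exact Module.finrank_pos
      obtain ⟨c, hc⟩ := (finrank_eq_one_iff_of_nonzero' (⟨r, hrR⟩ : Q.polarRadical)
        (fun h => hk1 (congrArg Subtype.val h))).1 h1 ⟨s, (hR s).2 hs⟩
      exact ⟨c, congrArg Subtype.val hc⟩
    have n1 : nilpOrder T x₀ = k + 1 := nilp_eq T x₀ k (hk0 _) hk1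
    have hQr : Q r ≠ 0 := hQR r hrR hk1
    have hrc : r ∈ cyc T x₀ := pow_mem_cyc _ _ _
    rcases k with _ | k
    · refine ⟨x₀, 0, ?_, ?_, ?_, Or.inr ⟨?_, ?_, ?_, ?_⟩⟩
      · rw [eq_bot_iff]
        rintro a ⟨-, ha⟩
        have := cyc_kill T (0 : V) 0 (by simp) a ha
        simpa using this
      · rw [eq_top_iff]
        rintro v -
        obtain ⟨c, rfl⟩ := hRspan v (by simpa using hcase v)
        exact Submodule.mem_sup_left (Submodule.smul_mem _ _ hrc)
      · have : nilpOrder T (0 : V) = 0 := by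
          unfold nilpOrder; exact Nat.sInf_eq_zero.2 (Or.inl (by simp))
        omega
      · have : nilpOrder T (0 : V) = 0 := by
          unfold nilpOrder; exact Nat.sInf_eq_zero.2 (Or.inl (by simp))
        omega
      · rw [n1]; exact hQr
      · simp
      · intro h; omega
    · obtain ⟨f, hf⟩ : ∃ f : V →ₗ[K] K, f r ≠ 0 := by
        by_contra hc
        push Not at hc
        exact hk1 ((Module.forall_dual_apply_eq_zero_iff K r).1 hc)
      let N : Submodule K V := 
        { carrier := {v | ∀ i, f ((T ^ i) v) = 0}
          add_mem' := by
            intro a b ha hb i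
            simp [ha i, hb i]
          zero_mem' := by intro i; simp
          smul_mem' := by
            intro c a ha i
            simp [ha i] }
      have hNinv : ∀ v ∈ N, T v ∈ N := by
        intro v hv i
        rw [pow_app_one]
        exact hv (i + 1)
      have hNz : ∀ a ∈ cyc T x₀, a ∈ N → a = 0 := fun a ha h =>
        cyc_eq_zero T f (k + 1) x₀ hf (hk0 _) a ha h
      have hNs : ∀ v, ∃ a ∈ cyc T x₀, v - a ∈ N := by
        intro v
        obtain ⟨a, ha, h⟩ := exists_sub T x₀ f (k + 1) hf (fun i hi => by simp [hkge i hi]) v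
        refine ⟨a, ha, fun i => ?_⟩
        rcases le_or_gt i (k + 1) with hi | hi
        · exact h i hi
        · simp [hkge i hi]
      obtain ⟨w, hw⟩ : ∃ w, B ((T ^ k) x₀) w ≠ 0 := by
        by_contra hc
        push Not at hc
        obtain ⟨c, hc⟩ := hRspan _ hc
        apply hk1
        rw [hr, ← app_pow, ← hc, map_smul, hr, app_pow, hk0, smul_zero]
      obtain ⟨a₀, ha₀, hwN⟩ := hNs w
      set y := w - a₀ with hy
      have hxy : B ((T ^ k) x₀) y ≠ 0 := by
        rw [hy, map_sub, hiso x₀ _ (pow_mem_cyc _ _ _) a₀ ha₀, sub_zero]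
        exact hw
      have hyx : B ((T ^ k) y) x₀ ≠ 0 := by rwa [adj_pow hadj, hsymm]
      have hy0 : (T ^ (k + 1)) y = 0 := by
        obtain ⟨c, hc⟩ := hRspan _ (hcase y)
        apply hNz
        · rw [← hc]; exact Submodule.smul_mem _ _ hrc
        · exact inv_pow hNinv _ _ hwN
      have n2 : nilpOrder T y = k + 1 := nilp_eq T y k hy0 (fun h => hyx (by simp [h]))
      have hcge : ∀ i, k < i → ∀ v z, B ((T ^ i) v) z = 0 := by
        intro i hi v z
        rcases Nat.lt_or_ge (k + 1) i with h | h
        · simp [hkge i h]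
        · have : i = k + 1 := by omega
          rw [this]; exact hcase v z
      let N₁ : Submodule K V := 
        { carrier := {v | v ∈ N ∧ ∀ i, B ((T ^ i) v) x₀ = 0}
          add_mem' := by
            intro a b ha hb
            exact ⟨add_mem ha.1 hb.1, fun i => by simp [ha.2 i, hb.2 i]⟩
          zero_mem' := ⟨zero_mem _, by intro i; simp⟩
          smul_mem' := by
            intro c a ha
            exact ⟨Submodule.smul_mem _ _ ha.1, fun i => by simp [ha.2 i]⟩ }
      have hN₁inv : ∀ v ∈ N₁, T v ∈ N₁ := by
        intro v hv
        refine ⟨hNinv v hv.1, fun i => ?_⟩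
        rw [pow_app_one]
        exact hv.2 (i + 1)
      have hyN : cyc T y ≤ N := cyc_le hNinv hwN
      have hNdec : ∀ v ∈ N, ∃ a ∈ cyc T y, v - a ∈ N₁ := by
        intro v hv
        obtain ⟨a, ha, h⟩ := exists_sub T y (B.flip x₀) k hyx
          (fun i hi => hcge i hi _ _) v
        refine ⟨a, ha, sub_mem hv (hyN ha), fun i => ?_⟩
        rcases le_or_gt i k with hi | hi
        · exact h i hi
        · exact hcge i hi _ _
      have hN₁nd : ∀ x ∈ N₁, (∀ z ∈ N₁, B x z = 0) → x = 0 := by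
        intro x hx hxz
        obtain ⟨a, ha, h⟩ := exists_sub T x₀ (B.flip y) k hxy
          (fun i hi => hcge i hi _ _) x
        have hxa : ∀ z, B (x - a) z = 0 := by
          intro z
          obtain ⟨b, hb, hzb⟩ := hNs z
          obtain ⟨c, hc, hzc⟩ := hNdec _ hzb
          have e : z = b + (c + (z - b - c)) := by abel
          have t1 : B (x - a) b = 0 := by
            rw [map_sub, LinearMap.sub_apply, hiso x₀ a ha b hb, orth_cyc hadj hx.2 b hb, sub_zero]
          have t2 : B (x - a) c = 0 := by
            refine orth_cyc hadj (fun i => ?_) c hc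
            rcases le_or_gt i k with hi | hi
            · exact h i hi
            · exact hcge i hi _ _
          have t3 : B (x - a) (z - b - c) = 0 := by
            rw [map_sub B x a, LinearMap.sub_apply, hxz _ hzc, hsymm a, orth_cyc hadj hzc.2 a ha, sub_zero]
          rw [e, map_add, map_add, t1, t2, t3, add_zero, add_zero]
        obtain ⟨c, hc⟩ := hRspan _ hxa
        refine hNz x ?_ hx.1
        have e : x = c • r + a := by rw [hc]; abel
        rw [e]
        exact add_mem (Submodule.smul_mem _ _ hrc) ha
      have hcompl : IsCompl N₁ (B.orthogonal N₁) := by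
        refine LinearMap.BilinForm.isCompl_orthogonal_of_restrict_nondegenerate hrefl ?_
        have hl : (B.restrict N₁).SeparatingLeft := by
          intro x hx
          exact Subtype.ext (hN₁nd x.1 x.2 fun z hz => hx ⟨z, hz⟩)
        refine ⟨hl, fun x hx => hl x fun z => ?_⟩
        have := hx z
        change B z.1 x.1 = 0 at this
        change B x.1 z.1 = 0
        rwa [hsymm]
      have hN₁ : N₁ = ⊥ := by
        refine (hind N₁ (B.orthogonal N₁) hN₁inv ?_ hcompl.inf_eq_bot hcompl.sup_eq_top ?_).resolve_right ?_
        · intro v hv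
          rw [LinearMap.BilinForm.mem_orthogonal_iff] at hv ⊢
          intro n hn
          change B n (T v) = 0
          rw [← hadj]
          exact hv _ (hN₁inv n hn)
        · intro a ha b hb
          exact hb a ha
        · intro h
          have : x₀ ∈ B.orthogonal N₁ := by
            rw [LinearMap.BilinForm.mem_orthogonal_iff]
            intro n hn
            exact orth_cyc hadj hn.2 x₀ (self_mem_cyc _ _)
          rw [h, Submodule.mem_bot] at this
          exact hk1 (by rw [hr, this, map_zero])
      refine ⟨x₀, y, ?_, ?_, ?_, Or.inr ⟨?_, ?_, ?_, ?_⟩⟩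
      · rw [eq_bot_iff]
        rintro a ⟨ha, hb⟩
        exact hNz a ha (hyN hb)
      · rw [eq_top_iff]
        rintro z -
        obtain ⟨b, hb, hzb⟩ := hNs z
        obtain ⟨c, hc, hzc⟩ := hNdec _ hzb
        rw [hN₁, Submodule.mem_bot] at hzc
        have e : z = b + c := by rw [sub_sub, sub_eq_zero] at hzc; exact hzc
        rw [e]
        exact Submodule.add_mem_sup hb hc
      · omega
      · omega
      · rw [n1]; exact hQr
      · rw [n1]; exact hcase _ _
      · intro _
        rw [n1]; exact hxy
end

section
/- Let q be a power of 2 and fix δ ∈ 𝐅_q with δ ∉ {x + x² : x ∈ 𝐅_q}. Every non-degenerate indecomposable form module over 𝐅_q is isomorphic to one of the following: W_l^0(m) for some m ≥ 1 and integer l with ⌊(m+1)/2⌋ ≤ l ≤ m; W_l^δ(m) for some m ≥ 1 and integer l with (m+1)/2 ≤ l ≤ m; or D(m) for some m ≥ 1. -/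
open Module Finset

/-- `(V, Q, T)` is isomorphic to the standard form module `W_l^ε(m)`:
it has a basis `T^i v₁, T^i v₂ (0 ≤ i ≤ m-1)` with `T^m v₁ = T^m v₂ = 0`,
`Q(T^i v₁) = 1` iff `i = l - 1` (else `0`), `Q(T^i v₂) = ε` iff `i = m - l` (else `0`),
`⟨T^i v₁, T^j v₂⟩ = 1` iff `i + j = m - 1` (else `0`), and
`⟨T^i v₁, T^j v₁⟩ = ⟨T^i v₂, T^j v₂⟩ = 0`.  (Taking `ε = 0` gives `W_l^0(m)`.) -/
def QuadraticForm.IsStandardW {F V : Type*} [Field F] [AddCommGroup V] [Module F V]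
    (Q : QuadraticForm F V) (T : Module.End F V) (ε : F) (l m : ℕ) : Prop :=
  ∃ v₁ v₂ : V,
    LinearIndependent F
      (Sum.elim (fun i : Fin m => (T ^ (i : ℕ)) v₁) (fun i : Fin m => (T ^ (i : ℕ)) v₂)) ∧
    Submodule.span F (Set.range
      (Sum.elim (fun i : Fin m => (T ^ (i : ℕ)) v₁) (fun i : Fin m => (T ^ (i : ℕ)) v₂))) = ⊤ ∧
    (T ^ m) v₁ = 0 ∧ (T ^ m) v₂ = 0 ∧
    (∀ i < m, Q ((T ^ i) v₁) = if i = l - 1 then 1 else 0) ∧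
    (∀ i < m, Q ((T ^ i) v₂) = if i = m - l then ε else 0) ∧
    (∀ i < m, ∀ j < m,
      QuadraticMap.polar Q ((T ^ i) v₁) ((T ^ j) v₂) = if i + j = m - 1 then 1 else 0) ∧
    (∀ i < m, ∀ j < m, QuadraticMap.polar Q ((T ^ i) v₁) ((T ^ j) v₁) = 0) ∧
    (∀ i < m, ∀ j < m, QuadraticMap.polar Q ((T ^ i) v₂) ((T ^ j) v₂) = 0)

/-- `(V, Q, T)` is isomorphic to the standard form module `D(m)`:
it has a basis `T^i v₁ (0 ≤ i ≤ m-1), T^i v₂ (0 ≤ i ≤ m-2)` with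
`T^m v₁ = T^{m-1} v₂ = 0`, `Q(T^i v₁) = 1` iff `i = m - 1` (else `0`), `Q(T^i v₂) = 0`,
`⟨T^i v₁, T^j v₂⟩ = 1` iff `i + j = m - 2` (else `0`), and
`⟨T^i v₁, T^j v₁⟩ = ⟨T^i v₂, T^j v₂⟩ = 0`. -/
def QuadraticForm.IsStandardD {F V : Type*} [Field F] [AddCommGroup V] [Module F V]
    (Q : QuadraticForm F V) (T : Module.End F V) (m : ℕ) : Prop :=
  ∃ v₁ v₂ : V,
    LinearIndependent F
      (Sum.elim (fun i : Fin m => (T ^ (i : ℕ)) v₁)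
        (fun i : Fin (m - 1) => (T ^ (i : ℕ)) v₂)) ∧
    Submodule.span F (Set.range
      (Sum.elim (fun i : Fin m => (T ^ (i : ℕ)) v₁)
        (fun i : Fin (m - 1) => (T ^ (i : ℕ)) v₂))) = ⊤ ∧
    (T ^ m) v₁ = 0 ∧ (T ^ (m - 1)) v₂ = 0 ∧
    (∀ i < m, Q ((T ^ i) v₁) = if i = m - 1 then 1 else 0) ∧
    (∀ i < m - 1, Q ((T ^ i) v₂) = 0) ∧
    (∀ i < m, ∀ j < m - 1,
      QuadraticMap.polar Q ((T ^ i) v₁) ((T ^ j) v₂) = if i + j = m - 2 then 1 else 0) ∧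
    (∀ i < m, ∀ j < m, QuadraticMap.polar Q ((T ^ i) v₁) ((T ^ j) v₁) = 0) ∧
    (∀ i < m - 1, ∀ j < m - 1, QuadraticMap.polar Q ((T ^ i) v₂) ((T ^ j) v₂) = 0)

section Aux

variable {F V : Type*} [Field F] [AddCommGroup V] [Module F V]

/-- Inverting a triangular system. -/
theorem aux_inv (a : ℕ → F) (M : ℕ) (hM : 1 ≤ M) (h0 : a (M - 1) ≠ 0) (h1 : ∀ i, M ≤ i → a i = 0) :
    ∃ c : ℕ → F, ∀ i, ∑ j ∈ range M, c j * a (i + j) = if i + 1 = M then 1 else 0 := by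
  let A : PowerSeries F := PowerSeries.mk fun j => if j < M then a (M - 1 - j) else 0
  have hA : PowerSeries.constantCoeff A ≠ 0 := by
    rw [← PowerSeries.coeff_zero_eq_constantCoeff_apply]
    simp only [A, PowerSeries.coeff_mk]
    rw [if_pos (by omega)]
    simpa using h0
  refine ⟨fun j => PowerSeries.coeff j A⁻¹, fun i => ?_⟩
  by_cases hi : i < M
  · have h2 : A⁻¹ * A = 1 := PowerSeries.inv_mul_cancel A hA
    have h3 := congrArg (PowerSeries.coeff (M - 1 - i)) h2
    rw [PowerSeries.coeff_mul, PowerSeries.coeff_one,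
      Finset.Nat.sum_antidiagonal_eq_sum_range_succ_mk] at h3
    have h4 : (if M - 1 - i = 0 then (1 : F) else 0) = if i + 1 = M then 1 else 0 := by
      congr 1; simp only [eq_iff_iff]; omega
    rw [← h4, ← h3]
    symm
    apply Finset.sum_subset_zero_on_sdiff
    · intro x hx; simp at hx ⊢; omega
    · intro x hx; simp at hx
      rw [h1 _ (by omega), mul_zero]
    · intro x hx; simp at hx
      simp only [A, PowerSeries.coeff_mk]
      rw [if_pos (by omega)]
      congr 2; omega
  · rw [if_neg (by omega)]
    apply Finset.sum_eq_zero
    intro j _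
    rw [h1 _ (by omega), mul_zero]

theorem aux_sq [Finite F] [CharP F 2] (a : F) : ∃ b : F, b ^ 2 = a := by
  have := (PerfectRing.toPerfectField F 2)
  obtain ⟨b, hb⟩ := surjective_frobenius F 2 a
  exact ⟨b, by simpa [frobenius_def] using hb⟩

theorem aux_AS [Fintype F] [CharP F 2] (δ : F) (hδ : ∀ x : F, δ ≠ x + x ^ 2) (g : F) :
    ∃ x : F, g + x ^ 2 + x = 0 ∨ g + x ^ 2 + x = δ := by
  classical
  let φ : F →+ F :=
    { toFun := fun x => x + x ^ 2
      map_zero' := by simp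
      map_add' := fun x y => by rw [CharTwo.add_sq]; ring }
  have hk : Nat.card φ.ker = 2 := by
    have : (φ.ker : Set F) = {0, 1} := by
      ext x
      simp only [SetLike.mem_coe, AddMonoidHom.mem_ker, Set.mem_insert_iff, Set.mem_singleton_iff]
      change x + x ^ 2 = 0 ↔ _
      constructor
      · intro h
        have h' : x * (1 + x) = 0 := by rw [← h]; ring
        rcases mul_eq_zero.1 h' with h | h
        · exact Or.inl h
        · exact Or.inr (CharTwo.add_eq_zero.1 h).symm
      · rintro (rfl | rfl)
        · simp
        · simpa using CharTwo.add_self_eq_zero (1 : F)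
    have h2 : Nat.card φ.ker = Set.ncard (φ.ker : Set F) := rfl
    rw [h2, this, Set.ncard_pair zero_ne_one]
  have hidx : φ.range.index = 2 := by
    have h1 : Nat.card φ.range * φ.range.index = Nat.card F := φ.range.card_mul_index
    have h2 : Nat.card φ.ker * φ.ker.index = Nat.card F := φ.ker.card_mul_index
    rw [AddSubgroup.index_ker, hk] at h2
    have h3 : 0 < Nat.card φ.range := Nat.card_pos
    rw [← h2, mul_comm 2] at h1
    exact Nat.eq_of_mul_eq_mul_left h3 h1
  have hd : δ ∉ φ.range := by
    rintro ⟨x, hx⟩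
    exact hδ x hx.symm
  by_cases hg : g ∈ φ.range
  · obtain ⟨x, hx⟩ := hg
    refine ⟨x, Or.inl ?_⟩
    have : x + x ^ 2 = g := hx
    rw [← this]
    have := CharTwo.add_self_eq_zero (x + x ^ 2)
    rw [← this]; ring
  · have := (AddSubgroup.add_mem_iff_of_index_two hidx (a := g) (b := δ)).2 (by tauto)
    obtain ⟨x, hx⟩ := this
    refine ⟨x, Or.inr ?_⟩
    have h5 : x + x ^ 2 = g + δ := hx
    have h6 : g + x ^ 2 + x = g + (x + x ^ 2) := by ring
    rw [h6, h5, ← add_assoc, CharTwo.add_self_eq_zero, zero_add]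

/-- The recursively defined coefficients. -/
noncomputable def auxR (s : F → F) (g : ℕ → F) (c : F) (l M D : ℕ) : ℕ → F
  | k =>
    if _h : k + 1 < D then
      s (g (l - 1 - k) + if _h' : D ≤ 2 * k + 1 then auxR s g c l M D (2 * k + 1 - D) else 0)
    else if _h2 : k + 1 = D then c
    else if _h3 : (k + 1) % 2 = D % 2 then
      g ((M - 1 - k) / 2) + auxR s g c l M D ((k + D - 1) / 2) ^ 2
    else 0
  termination_by k => k
  decreasing_by all_goals omega

theorem aux_solve [Fintype F] [CharP F 2] (δ : F) (hδ : ∀ x : F, δ ≠ x + x ^ 2)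
    (g : ℕ → F) (l M : ℕ) (hM : M ≤ 2 * l) :
    ∃ (r : ℕ → F) (ε : F), (ε = 0 ∨ (ε = δ ∧ M + 1 ≤ 2 * l)) ∧
      ∀ i, i < l → g i + r (l - 1 - i) ^ 2 + (if 2 * i + 1 ≤ M then r (M - 1 - 2 * i) else 0)
        = if i + l = M then ε else 0 := by
  choose s hs using aux_sq (F := F)
  obtain ⟨c, hc⟩ := aux_AS δ hδ (g (M - l))
  let r := auxR s g c l M (2 * l - M)
  let ε : F := if M + 1 ≤ 2 * l then g (M - l) + c ^ 2 + c else 0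
  refine ⟨r, ε, ?_, ?_⟩
  · simp only [ε]
    split_ifs with h
    · tauto
    · tauto
  intro i hi
  rcases lt_trichotomy (i + l) M with h | h | h
  · rw [if_neg (show ¬ i + l = M by omega), if_pos (by omega)]
    have h1 : r (M - 1 - 2 * i) = g i + r (l - 1 - i) ^ 2 := by
      simp only [r]
      rw [auxR, dif_neg (by omega), dif_neg (by omega), dif_pos (by omega)]
      congr 2
      · omega
      · congr 1; omega
    rw [h1]; exact CharTwo.add_self_eq_zero _
  · rw [if_pos h, if_pos (by omega)]
    have h1 : r (l - 1 - i) = c := by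
      simp only [r]
      rw [auxR, dif_neg (by omega), dif_pos (by omega)]
    have h2 : M - 1 - 2 * i = l - 1 - i := by omega
    have h3 : M - l = i := by omega
    rw [h2, h1]
    simp only [ε]
    rw [if_pos (by omega), h3]
  · rw [if_neg (show ¬ i + l = M by omega)]
    have h1 : r (l - 1 - i) ^ 2 = g i + (if 2 * i + 1 ≤ M then r (M - 1 - 2 * i) else 0) := by
      simp only [r]
      rw [auxR, dif_pos (by omega), hs]
      have e1 : l - 1 - (l - 1 - i) = i := by omega
      have e2 : 2 * (l - 1 - i) + 1 - (2 * l - M) = M - 1 - 2 * i := by omega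
      rw [e1, e2]
      congr 1
      by_cases h5 : 2 * i + 1 ≤ M
      · rw [dif_pos (by omega), if_pos h5]
      · rw [dif_neg (by omega), if_neg h5]
    rw [h1, ← add_assoc, CharTwo.add_self_eq_zero, zero_add, CharTwo.add_self_eq_zero]

/-- `T` is self-adjoint and `⟨T^i x, x⟩ = 0`. -/
structure AuxFM (B : LinearMap.BilinForm F V) (Q : QuadraticForm F V) (T : Module.End F V) :
    Prop where
  symm : ∀ x y, B x y = B y x
  adj : ∀ x y, B (T x) y = B x (T y)
  alt : ∀ x, B x x = 0
  altT : ∀ x, B (T x) x = 0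
  add : ∀ x y, Q (x + y) = Q x + Q y + B x y

namespace AuxFM

variable {B : LinearMap.BilinForm F V} {Q : QuadraticForm F V} {T : Module.End F V}

theorem adj_pow (h : AuxFM B Q T) (i : ℕ) : ∀ x y, B ((T ^ i) x) y = B x ((T ^ i) y) := by
  induction i with
  | zero => intro x y; rfl
  | succ n ih =>
    intro x y
    rw [pow_succ, Module.End.mul_apply, ih, h.adj, ← Module.End.mul_apply, ← pow_succ',
      pow_succ]

theorem adj_pow2 (h : AuxFM B Q T) (i j : ℕ) (x y : V) :
    B ((T ^ i) x) ((T ^ j) y) = B ((T ^ (i + j)) x) y := by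
  rw [← h.adj_pow j, ← Module.End.mul_apply, ← pow_add, add_comm]

theorem alt_pow (h : AuxFM B Q T) (i : ℕ) (x : V) : B ((T ^ i) x) x = 0 := by
  rcases Nat.even_or_odd' i with ⟨k, rfl | rfl⟩
  · rw [two_mul, ← h.adj_pow2, h.alt]
  · have : 2 * k + 1 = (k + 1) + k := by ring
    rw [this, ← h.adj_pow2, pow_succ', Module.End.mul_apply, h.altT]

theorem alt_pow2 (h : AuxFM B Q T) (i j : ℕ) (x : V) : B ((T ^ i) x) ((T ^ j) x) = 0 := by
  rw [h.adj_pow2, h.alt_pow]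

theorem Q_poly (h : AuxFM B Q T) (c : ℕ → F) (v : V) (i n : ℕ) :
    Q ((T ^ i) (∑ j ∈ range n, c j • (T ^ j) v)) = ∑ j ∈ range n, c j ^ 2 * Q ((T ^ (i + j)) v) := by
  induction n with
  | zero => simp
  | succ n ih =>
    rw [sum_range_succ, sum_range_succ, map_add, h.add, ih]
    have : B ((T ^ i) (∑ j ∈ range n, c j • (T ^ j) v)) ((T ^ i) (c n • (T ^ n) v)) = 0 := by
      simp only [map_sum, map_smul, LinearMap.sum_apply, LinearMap.smul_apply,
        ← Module.End.mul_apply, ← pow_add, h.alt_pow2, smul_zero, sum_const_zero]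
    rw [this, map_smul, QuadraticMap.map_smul, ← Module.End.mul_apply, ← pow_add]
    simp only [smul_eq_mul]; ring

theorem B_poly (h : AuxFM B Q T) (c : ℕ → F) (v w : V) (i n : ℕ) :
    B ((T ^ i) v) (∑ j ∈ range n, c j • (T ^ j) w) =
      ∑ j ∈ range n, c j * B ((T ^ (i + j)) v) w := by
  simp only [map_sum, map_smul, smul_eq_mul, h.adj_pow2]

theorem pow_poly (c : ℕ → F) (v : V) (i n : ℕ) :
    (T ^ i) (∑ j ∈ range n, c j • (T ^ j) v) = ∑ j ∈ range n, c j • (T ^ (i + j)) v := by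
  simp only [map_sum, map_smul, ← Module.End.mul_apply, ← pow_add]

theorem pow_zero_of_le {v : V} {m i : ℕ} (h : (T ^ m) v = 0) (hi : m ≤ i) : (T ^ i) v = 0 := by
  obtain ⟨k, rfl⟩ := Nat.exists_eq_add_of_le hi
  rw [add_comm, pow_add, Module.End.mul_apply, h, map_zero]

theorem poly_zero {v : V} {m : ℕ} (h : (T ^ m) v = 0) (c : ℕ → F) (n : ℕ) :
    (T ^ m) (∑ j ∈ range n, c j • (T ^ j) v) = 0 := by
  rw [pow_poly]
  exact sum_eq_zero fun j _ => by rw [pow_zero_of_le h (by omega), smul_zero]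

/-- Normalising the pairing. -/
theorem norm_pair (h : AuxFM B Q T) {v₁ v₂ : V} {M : ℕ} (hM : 1 ≤ M)
    (h0 : B ((T ^ (M - 1)) v₁) v₂ ≠ 0) (h1 : ∀ i, M ≤ i → B ((T ^ i) v₁) v₂ = 0) :
    ∃ c : ℕ → F, ∀ i, B ((T ^ i) v₁) (∑ j ∈ range M, c j • (T ^ j) v₂) =
      if i + 1 = M then 1 else 0 := by
  obtain ⟨c, hc⟩ := aux_inv (fun i => B ((T ^ i) v₁) v₂) M hM h0 h1
  exact ⟨c, fun i => by rw [h.B_poly, ← hc i]⟩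

/-- Normalising the quadratic form. -/
theorem norm_Q [Finite F] [CharP F 2] (h : AuxFM B Q T) {v₁ : V} {l : ℕ} (hl : 1 ≤ l)
    (h0 : Q ((T ^ (l - 1)) v₁) ≠ 0) (h1 : ∀ i, l ≤ i → Q ((T ^ i) v₁) = 0) :
    ∃ c : ℕ → F, ∀ i, Q ((T ^ i) (∑ j ∈ range l, c j • (T ^ j) v₁)) =
      if i + 1 = l then 1 else 0 := by
  obtain ⟨c, hc⟩ := aux_inv (fun i => Q ((T ^ i) v₁)) l hl h0 h1
  choose s hs using aux_sq (F := F)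
  refine ⟨fun i => s (c i), fun i => ?_⟩
  rw [h.Q_poly, ← hc i]
  simp only [hs]

theorem pow_poly_zero_aux (h : AuxFM B Q T) {v : V} {i n : ℕ} {r : ℕ → F} :
    B ((T ^ i) v) (∑ j ∈ range n, r j • (T ^ j) v) = 0 := by
  rw [h.B_poly]
  exact sum_eq_zero fun j _ => by rw [h.alt_pow, mul_zero]

/-- Normalising the second generator. -/
theorem core [Fintype F] [CharP F 2] (h : AuxFM B Q T)
    (δ : F) (hδ : ∀ x : F, δ ≠ x + x ^ 2) {v₁ v₂ : V} {l M : ℕ} (hM : M ≤ 2 * l)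
    (hQ1 : ∀ n, Q ((T ^ n) v₁) = if n + 1 = l then 1 else 0)
    (hB : ∀ n, B ((T ^ n) v₁) v₂ = if n + 1 = M then 1 else 0)
    (hQ2 : ∀ n, l ≤ n → Q ((T ^ n) v₂) = 0) :
    ∃ (r : ℕ → F) (n : ℕ) (ε : F), (ε = 0 ∨ (ε = δ ∧ M + 1 ≤ 2 * l)) ∧
      (∀ i, Q ((T ^ i) (v₂ + ∑ j ∈ range n, r j • (T ^ j) v₁)) = if i + l = M then ε else 0) ∧
      (∀ i, B ((T ^ i) v₁) (v₂ + ∑ j ∈ range n, r j • (T ^ j) v₁) =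
        if i + 1 = M then 1 else 0) ∧
      (M < l → Q ((T ^ (l - 1)) v₂) = 0 → r 0 = 0) := by
  obtain ⟨r, ε, hε, hr⟩ := aux_solve δ hδ (fun i => Q ((T ^ i) v₂)) l M hM
  refine ⟨r, l + M, ε, hε, fun i => ?_, fun i => ?_, fun h1 h2 => ?_⟩
  · have key : Q ((T ^ i) (v₂ + ∑ j ∈ range (l + M), r j • (T ^ j) v₁)) =
        Q ((T ^ i) v₂) + (if i < l then r (l - 1 - i) ^ 2 else 0)
          + (if 2 * i + 1 ≤ M then r (M - 1 - 2 * i) else 0) := by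
      rw [map_add, h.add, h.Q_poly]
      congr 1
      · congr 1
        simp only [hQ1]
        split_ifs with hi
        · rw [sum_eq_single (l - 1 - i)]
          · rw [if_pos (by omega), mul_one]
          · intro j _ hj; rw [if_neg (by omega), mul_zero]
          · intro hj; simp at hj; omega
        · exact sum_eq_zero fun j _ => by rw [if_neg (by omega), mul_zero]
      · rw [h.symm, pow_poly, map_sum, LinearMap.sum_apply]
        simp only [map_smul, LinearMap.smul_apply, h.adj_pow2, hB, smul_eq_mul]
        split_ifs with hi
        · rw [sum_eq_single (M - 1 - 2 * i)]
          · rw [if_pos (by omega), mul_one]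
          · intro j _ hj; rw [if_neg (by omega), mul_zero]
          · intro hj; simp at hj; omega
        · exact sum_eq_zero fun j _ => by rw [if_neg (by omega), mul_zero]
    rw [key]
    by_cases hi : i < l
    · rw [if_pos hi]; exact hr i hi
    · rw [hQ2 i (by omega), if_neg hi, if_neg (show ¬ 2 * i + 1 ≤ M by omega)]
      split_ifs with h5
      · rcases hε with h6 | h6
        · rw [h6]; simp
        · omega
      · simp
  · rw [map_add, hB, pow_poly_zero_aux h, add_zero]
  · have := hr (l - 1) (by omega)
    simp only [h2] at this
    rw [if_neg (show ¬ 2 * (l - 1) + 1 ≤ M by omega), if_neg (show ¬ l - 1 + l = M by omega)] at this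
    simpa using this

/-- The submodule generated by two vectors. -/
def S0 (T : Module.End F V) (v₁ v₂ : V) : Submodule F V :=
  Submodule.span F (Set.range (fun i : ℕ => (T ^ i) v₁) ∪ Set.range (fun i : ℕ => (T ^ i) v₂))

theorem mem1 (v₁ v₂ : V) (i : ℕ) : (T ^ i) v₁ ∈ S0 T v₁ v₂ :=
  Submodule.subset_span (Or.inl ⟨i, rfl⟩)

theorem mem2 (v₁ v₂ : V) (i : ℕ) : (T ^ i) v₂ ∈ S0 T v₁ v₂ :=
  Submodule.subset_span (Or.inr ⟨i, rfl⟩)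

theorem S0_induction {v₁ v₂ : V} {p : V → Prop} (h1 : ∀ i, p ((T ^ i) v₁))
    (h2 : ∀ i, p ((T ^ i) v₂)) (h0 : p 0) (ha : ∀ x y, p x → p y → p (x + y))
    (hs : ∀ (a : F) x, p x → p (a • x)) : ∀ x ∈ S0 T v₁ v₂, p x := by
  intro x hx
  induction hx using Submodule.span_induction with
  | mem x hx =>
    rcases hx with ⟨i, rfl⟩ | ⟨i, rfl⟩
    · exact h1 i
    · exact h2 i
  | zero => exact h0
  | add x y _ _ hx hy => exact ha x y hx hy
  | smul a x _ hx => exact hs a x hx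

theorem S0_inv {v₁ v₂ : V} : ∀ x ∈ S0 T v₁ v₂, T x ∈ S0 T v₁ v₂ := by
  apply S0_induction
  · intro i; rw [← Module.End.mul_apply, ← pow_succ']; exact mem1 _ _ _
  · intro i; rw [← Module.End.mul_apply, ← pow_succ']; exact mem2 _ _ _
  · simp
  · intro x y hx hy; rw [map_add]; exact add_mem hx hy
  · intro a x hx; rw [map_smul]; exact Submodule.smul_mem _ _ hx

theorem S0_decomp {v₁ v₂ : V} : ∀ x ∈ S0 T v₁ v₂, ∃ (a b : F) (u : V),
    x = a • v₁ + b • v₂ + T u := by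
  apply S0_induction
  · intro i
    rcases i with _ | i
    · exact ⟨1, 0, 0, by simp⟩
    · exact ⟨0, 0, (T ^ i) v₁, by rw [pow_succ', Module.End.mul_apply]; simp⟩
  · intro i
    rcases i with _ | i
    · exact ⟨0, 1, 0, by simp⟩
    · exact ⟨0, 0, (T ^ i) v₂, by rw [pow_succ', Module.End.mul_apply]; simp⟩
  · exact ⟨0, 0, 0, by simp⟩
  · rintro x y ⟨a, b, u, rfl⟩ ⟨a', b', u', rfl⟩
    exact ⟨a + a', b + b', u + u', by rw [map_add]; module⟩
  · rintro c x ⟨a, b, u, rfl⟩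
    exact ⟨c * a, c * b, c • u, by rw [map_smul]; module⟩

/-- Projection to the span. -/
noncomputable def proj (B : LinearMap.BilinForm F V) (T : Module.End F V) (v₁ v₂ : V) (M : ℕ)
    (x : V) : V :=
  ∑ i ∈ range M, B x ((T ^ (M - 1 - i)) v₂) • (T ^ i) v₁ +
    ∑ i ∈ range M, B x ((T ^ (M - 1 - i)) v₁) • (T ^ i) v₂

theorem proj_mem (v₁ v₂ : V) (M : ℕ) (x : V) : proj B T v₁ v₂ M x ∈ S0 T v₁ v₂ :=
  add_mem (sum_mem fun _ _ => Submodule.smul_mem _ _ (mem1 _ _ _))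
    (sum_mem fun _ _ => Submodule.smul_mem _ _ (mem2 _ _ _))

theorem B12 (h : AuxFM B Q T) {v₁ v₂ : V} {M : ℕ}
    (hB : ∀ n, B ((T ^ n) v₁) v₂ = if n + 1 = M then 1 else 0) (i j : ℕ) :
    B ((T ^ i) v₁) ((T ^ j) v₂) = if i + j + 1 = M then 1 else 0 := by
  rw [h.adj_pow2, hB]

theorem B21 (h : AuxFM B Q T) {v₁ v₂ : V} {M : ℕ}
    (hB : ∀ n, B ((T ^ n) v₁) v₂ = if n + 1 = M then 1 else 0) (i j : ℕ) :
    B ((T ^ i) v₂) ((T ^ j) v₁) = if i + j + 1 = M then 1 else 0 := by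
  rw [h.symm, h.B12 hB, add_comm i j]

theorem proj_perp (h : AuxFM B Q T) {v₁ v₂ : V} {M : ℕ}
    (hB : ∀ n, B ((T ^ n) v₁) v₂ = if n + 1 = M then 1 else 0)
    (h1 : ∀ x, B ((T ^ M) v₁) x = 0) (h2 : ∀ x, B ((T ^ M) v₂) x = 0) (x : V) :
    ∀ s ∈ S0 T v₁ v₂, B s (x - proj B T v₁ v₂ M x) = 0 := by
  have hbig : ∀ v, (∀ x, B ((T ^ M) v) x = 0) → ∀ k, M ≤ k → ∀ x, B ((T ^ k) v) x = 0 := by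
    intro v hv k hk x
    obtain ⟨n, rfl⟩ := Nat.exists_eq_add_of_le hk
    rw [← h.adj_pow2]; exact hv _
  apply S0_induction
  · intro k
    by_cases hk : k < M
    · rw [map_sub, proj, map_add, map_sum, map_sum]
      simp only [map_smul, h.alt_pow2, h.B12 hB, smul_zero, sum_const_zero, zero_add]
      rw [sum_eq_single (M - 1 - k)]
      · rw [if_pos (by omega), show M - 1 - (M - 1 - k) = k by omega, h.symm]
        simp
      · intro j _ hj; rw [if_neg (by omega), smul_zero]
      · intro hj; simp at hj; omega
    · exact hbig _ h1 k (by omega) _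
  · intro k
    by_cases hk : k < M
    · rw [map_sub, proj, map_add, map_sum, map_sum]
      simp only [map_smul, h.alt_pow2, h.B21 hB, smul_zero, sum_const_zero, add_zero]
      rw [sum_eq_single (M - 1 - k)]
      · rw [if_pos (by omega), show M - 1 - (M - 1 - k) = k by omega, h.symm]
        simp
      · intro j _ hj; rw [if_neg (by omega), smul_zero]
      · intro hj; simp at hj; omega
    · exact hbig _ h2 k (by omega) _
  · simp
  · intro x y hx hy; rw [map_add, LinearMap.add_apply, hx, hy, add_zero]
  · intro a x hx; rw [map_smul, LinearMap.smul_apply, hx, smul_zero]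

theorem proj_self (h : AuxFM B Q T) {v₁ v₂ : V} {M : ℕ}
    (hB : ∀ n, B ((T ^ n) v₁) v₂ = if n + 1 = M then 1 else 0)
    (h1 : (T ^ M) v₁ = 0) (h2 : (T ^ M) v₂ = 0) :
    ∀ s ∈ S0 T v₁ v₂, proj B T v₁ v₂ M s = s := by
  apply S0_induction
  · intro k
    simp only [proj, h.alt_pow2, h.B12 hB, zero_smul, sum_const_zero, add_zero]
    by_cases hk : k < M
    · rw [sum_eq_single k]
      · rw [if_pos (by omega), one_smul]
      · intro j hj' hj; simp at hj'; rw [if_neg (by omega), zero_smul]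
      · intro hj; simp at hj; omega
    · rw [pow_zero_of_le h1 (by omega)]
      exact sum_eq_zero fun j hj => by simp at hj; rw [if_neg (by omega), zero_smul]
  · intro k
    simp only [proj, h.alt_pow2, h.B21 hB, zero_smul, sum_const_zero, zero_add]
    by_cases hk : k < M
    · rw [sum_eq_single k]
      · rw [if_pos (by omega), one_smul]
      · intro j hj' hj; simp at hj'; rw [if_neg (by omega), zero_smul]
      · intro hj; simp at hj; omega
    · rw [pow_zero_of_le h2 (by omega)]
      exact sum_eq_zero fun j hj => by simp at hj; rw [if_neg (by omega), zero_smul]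
  · simp [proj]
  · intro x y hx hy
    conv_rhs => rw [← hx, ← hy]
    simp only [proj, map_add, LinearMap.add_apply, add_smul, sum_add_distrib]
    abel
  · intro a x hx
    conv_rhs => rw [← hx]
    simp only [proj, map_smul, LinearMap.smul_apply, smul_add, smul_sum, smul_assoc]

theorem orth_inv (h : AuxFM B Q T) {S : Submodule F V} (hS : ∀ x ∈ S, T x ∈ S) :
    ∀ x ∈ B.orthogonal S, T x ∈ B.orthogonal S := by
  intro x hx
  rw [LinearMap.BilinForm.mem_orthogonal_iff] at hx ⊢
  intro n hn
  have := hx (T n) (hS n hn)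
  change B (T n) x = 0 at this
  change B n (T x) = 0
  rw [← h.adj, this]

/-- Splitting off a `W` block. -/
theorem split (h : AuxFM B Q T) (hBQ : ∀ x y, QuadraticMap.polar Q x y = B x y)
    (hind : Q.FormModuleIndecomposable T) {v₁ v₂ : V} {M : ℕ} (hM : 1 ≤ M)
    (hB : ∀ n, B ((T ^ n) v₁) v₂ = if n + 1 = M then 1 else 0)
    (h1 : (T ^ M) v₁ = 0) (h2 : (T ^ M) v₂ = 0) :
    S0 T v₁ v₂ = ⊤ ∧ ∀ x, (∀ s ∈ S0 T v₁ v₂, B s x = 0) → x = 0 := by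
  have hperp := h.proj_perp hB (by simp [h1]) (by simp [h2])
  have hsup : S0 T v₁ v₂ ⊔ B.orthogonal (S0 T v₁ v₂) = ⊤ := by
    rw [eq_top_iff]
    intro x _
    rw [← add_sub_cancel (proj B T v₁ v₂ M x) x]
    apply Submodule.add_mem_sup (proj_mem _ _ _ _)
    rw [LinearMap.BilinForm.mem_orthogonal_iff]
    exact hperp x
  have hinf : S0 T v₁ v₂ ⊓ B.orthogonal (S0 T v₁ v₂) = ⊥ := by
    rw [eq_bot_iff]
    rintro x ⟨hx, hx'⟩
    have h3 := h.proj_self hB h1 h2 x hx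
    have h4 : ∀ s ∈ S0 T v₁ v₂, B x s = 0 := fun s hs => by
      rw [h.symm]; exact (LinearMap.BilinForm.mem_orthogonal_iff.1 hx') s hs
    rw [Submodule.mem_bot, ← h3, proj]
    simp [h4 _ (mem1 v₁ v₂ _), h4 _ (mem2 v₁ v₂ _)]
  have hv : v₁ ≠ 0 := by
    rintro rfl
    have := hB (M - 1)
    rw [if_pos (by omega)] at this
    simp at this
  have hne : S0 T v₁ v₂ ≠ ⊥ := by
    intro hbot
    have := mem1 (T := T) v₁ v₂ 0
    rw [hbot] at this
    exact hv (by simpa using this)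
  have hbot : B.orthogonal (S0 T v₁ v₂) = ⊥ := by
    refine (hind _ _ S0_inv (h.orth_inv S0_inv) hinf hsup ?_).resolve_left hne
    intro x hx y hy
    rw [hBQ]
    exact (LinearMap.BilinForm.mem_orthogonal_iff.1 hy) x hx
  refine ⟨by rw [← hsup, hbot, sup_bot_eq], fun x hx => ?_⟩
  have : x ∈ B.orthogonal (S0 T v₁ v₂) := LinearMap.BilinForm.mem_orthogonal_iff.2 hx
  rw [hbot] at this
  simpa using this

theorem split' (h : AuxFM B Q T) (hBQ : ∀ x y, QuadraticMap.polar Q x y = B x y)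
    (hind : Q.FormModuleIndecomposable T) {v₁ v₂ : V} {M : ℕ} (hM : 1 ≤ M)
    (hB : B ((T ^ (M - 1)) v₁) v₂ ≠ 0)
    (h1 : (T ^ M) v₁ = 0) (h2 : (T ^ M) v₂ = 0) :
    ∃ w₂, (T ^ M) w₂ = 0 ∧ (∀ n, B ((T ^ n) v₁) w₂ = if n + 1 = M then 1 else 0) ∧
    S0 T v₁ w₂ = ⊤ ∧ ∀ x, (∀ s ∈ S0 T v₁ w₂, B s x = 0) → x = 0 := by
  obtain ⟨c, hc⟩ := h.norm_pair hM hB (fun i hi => by rw [pow_zero_of_le h1 hi]; simp)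
  exact ⟨_, poly_zero h2 c M, hc, h.split hBQ hind hM hc h1 (poly_zero h2 c M)⟩

theorem LI {ι : Type*} [Fintype ι] [DecidableEq ι] (b : ι → V)
    (hb : ∀ i, (∃ f : V →ₗ[F] F, ∀ j, f (b j) = if j = i then 1 else 0) ∨
      (b i ≠ 0 ∧ ∀ k, k ≠ i → ∃ f : V →ₗ[F] F, ∀ j, f (b j) = if j = k then 1 else 0)) :
    LinearIndependent F b := by
  rw [Fintype.linearIndependent_iff]
  intro g hg
  have key : ∀ i, (∃ f : V →ₗ[F] F, ∀ j, f (b j) = if j = i then 1 else 0) → g i = 0 := by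
    rintro i ⟨f, hf⟩
    have := congrArg f hg
    simpa [hf] using this
  intro i
  rcases hb i with h | ⟨h0, h⟩
  · exact key i h
  · rw [sum_eq_single i (fun j _ hj => by rw [key j (h j hj), zero_smul])
      (fun hi => absurd (mem_univ i) hi)] at hg
    exact (smul_eq_zero.1 hg).resolve_right h0

theorem span_fam {v₁ v₂ : V} {m n : ℕ} (h1 : (T ^ m) v₁ = 0) (h2 : (T ^ n) v₂ = 0)
    (hS : S0 T v₁ v₂ = ⊤) :
    Submodule.span F (Set.range
      (Sum.elim (fun i : Fin m => (T ^ (i : ℕ)) v₁) (fun i : Fin n => (T ^ (i : ℕ)) v₂))) = ⊤ := by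
  rw [eq_top_iff, ← hS]
  apply S0_induction
  · intro i
    by_cases hi : i < m
    · exact Submodule.subset_span ⟨Sum.inl ⟨i, hi⟩, rfl⟩
    · rw [pow_zero_of_le h1 (by omega)]; exact zero_mem _
  · intro i
    by_cases hi : i < n
    · exact Submodule.subset_span ⟨Sum.inr ⟨i, hi⟩, rfl⟩
    · rw [pow_zero_of_le h2 (by omega)]; exact zero_mem _
  · exact zero_mem _
  · exact fun x y hx hy => add_mem hx hy
  · exact fun a x hx => Submodule.smul_mem _ _ hx

theorem stdW (h : AuxFM B Q T) (hBQ : ∀ x y, QuadraticMap.polar Q x y = B x y)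
    {v₁ v₂ : V} {l m : ℕ} {ε : F} (hl : 1 ≤ l) (hlm : l ≤ m)
    (hB : ∀ n, B ((T ^ n) v₁) v₂ = if n + 1 = m then 1 else 0)
    (h1 : (T ^ m) v₁ = 0) (h2 : (T ^ m) v₂ = 0) (hS : S0 T v₁ v₂ = ⊤)
    (hQ1 : ∀ n, Q ((T ^ n) v₁) = if n + 1 = l then 1 else 0)
    (hQ2 : ∀ n, Q ((T ^ n) v₂) = if n + l = m then ε else 0) :
    Q.IsStandardW T ε l m := by
  refine ⟨v₁, v₂, ?_, span_fam h1 h2 hS, h1, h2, ?_, ?_, ?_, ?_, ?_⟩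
  · apply LI
    rintro (i | i)
    · refine Or.inl ⟨B ((T ^ (m - 1 - i)) v₂), ?_⟩
      rintro (j | j)
      · simp only [Sum.elim_inl, h.B21 hB, Sum.inl.injEq, Fin.ext_iff]
        congr 1; simp only [eq_iff_iff]; omega
      · simp [h.alt_pow2]
    · refine Or.inl ⟨B ((T ^ (m - 1 - i)) v₁), ?_⟩
      rintro (j | j)
      · simp [h.alt_pow2]
      · simp only [Sum.elim_inr, h.B12 hB, Sum.inr.injEq, Fin.ext_iff]
        congr 1; simp only [eq_iff_iff]; omega
  · intro i hi
    rw [hQ1]; congr 1; simp only [eq_iff_iff]; omega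
  · intro i hi
    rw [hQ2]; congr 1; simp only [eq_iff_iff]; omega
  · intro i hi j hj
    rw [hBQ, h.B12 hB]; congr 1; simp only [eq_iff_iff]; omega
  · intro i _ j _; rw [hBQ, h.alt_pow2]
  · intro i _ j _; rw [hBQ, h.alt_pow2]

theorem stdD (h : AuxFM B Q T) (hBQ : ∀ x y, QuadraticMap.polar Q x y = B x y)
    {v₁ v₂ : V} {k : ℕ}
    (hB : ∀ n, B ((T ^ n) v₁) v₂ = if n + 1 = k then 1 else 0)
    (h1 : (T ^ (k + 1)) v₁ = 0) (h2 : (T ^ k) v₂ = 0) (hS : S0 T v₁ v₂ = ⊤)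
    (hQ1 : ∀ n, Q ((T ^ n) v₁) = if n = k then 1 else 0)
    (hQ2 : ∀ n, Q ((T ^ n) v₂) = 0) :
    Q.IsStandardD T (k + 1) := by
  refine ⟨v₁, v₂, ?_, span_fam h1 h2 hS, h1, h2, ?_, ?_, ?_, ?_, ?_⟩
  · apply LI
    have key : ∀ i : Fin (k + 1) ⊕ Fin (k + 1 - 1), i ≠ Sum.inl (Fin.last k) →
        ∃ f : V →ₗ[F] F, ∀ j, f (Sum.elim (fun i : Fin (k + 1) => (T ^ (i : ℕ)) v₁)
          (fun i : Fin (k + 1 - 1) => (T ^ (i : ℕ)) v₂) j) = if j = i then 1 else 0 := by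
      rintro (i | i) hi
      · have hi' : (i : ℕ) ≠ k := fun hh => hi (by congr 1; exact Fin.ext hh)
        refine ⟨B ((T ^ (k - 1 - i)) v₂), ?_⟩
        rintro (j | j)
        · simp only [Sum.elim_inl, h.B21 hB, Sum.inl.injEq, Fin.ext_iff]
          congr 1; simp only [eq_iff_iff]; omega
        · simp [h.alt_pow2]
      · refine ⟨B ((T ^ (k - 1 - i)) v₁), ?_⟩
        rintro (j | j)
        · simp [h.alt_pow2]
        · simp only [Sum.elim_inr, h.B12 hB, Sum.inr.injEq, Fin.ext_iff]
          congr 1; simp only [eq_iff_iff]; omega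
    intro i
    by_cases hi : i = Sum.inl (Fin.last k)
    · subst hi
      refine Or.inr ⟨?_, key⟩
      intro h0
      have h3 := hQ1 k
      simp only [Sum.elim_inl, Fin.val_last] at h0
      rw [h0] at h3
      simp at h3
    · exact Or.inl (key i hi)
  · intro i hi
    rw [hQ1]; rfl
  · intro i hi
    exact hQ2 i
  · intro i hi j hj
    rw [hBQ, h.B12 hB]; congr 1; simp only [eq_iff_iff]; omega
  · intro i _ j _; rw [hBQ, h.alt_pow2]
  · intro i _ j _; rw [hBQ, h.alt_pow2]

/-- The non-defective case. -/
theorem nondef [Fintype F] [CharP F 2] [Nontrivial V] (h : AuxFM B Q T)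
    (δ : F) (hδ : ∀ x : F, δ ≠ x + x ^ 2)
    (hBQ : ∀ x y, QuadraticMap.polar Q x y = B x y)
    (hind : Q.FormModuleIndecomposable T) (hnil : IsNilpotent T)
    (hnd : ∀ x, (∀ y, B x y = 0) → x = 0) :
    ∃ (m l : ℕ) (ε : F), 1 ≤ m ∧ (ε = 0 ∨ (ε = δ ∧ m + 1 ≤ 2 * l)) ∧ m ≤ 2 * l ∧ l ≤ m ∧
      Q.IsStandardW T ε l m := by
  classical
  obtain ⟨m, hm, hmin⟩ : ∃ m, T ^ m = 0 ∧ ∀ n, n < m → T ^ n ≠ 0 :=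
    ⟨Nat.find hnil, Nat.find_spec hnil, fun n hn => Nat.find_min hnil hn⟩
  have hm1 : 1 ≤ m := by
    rcases Nat.eq_zero_or_pos m with rfl | h0
    · obtain ⟨x, hx⟩ := exists_ne (0 : V)
      exact absurd (by simpa using congrArg (fun f : Module.End F V => f x) hm) hx
    · exact h0
  have hmz : ∀ x, (T ^ m) x = 0 := fun x => by rw [hm]; rfl
  have hdual : ∀ x, (T ^ (m - 1)) x ≠ 0 → ∃ y, B ((T ^ (m - 1)) x) y ≠ 0 := by
    intro x hx
    by_contra! hc
    exact hx (hnd _ hc)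
  obtain ⟨u₁, hu₁⟩ : ∃ u, (T ^ (m - 1)) u ≠ 0 := by
    by_contra! hc
    exact hmin (m - 1) (by omega) (LinearMap.ext hc)
  obtain ⟨y, hy⟩ := hdual u₁ hu₁
  obtain ⟨u₂, -, hu, hS, -⟩ := h.split' hBQ hind hm1 hy (hmz _) (hmz _)
  have hex : ∃ l, ∀ i, l ≤ i → ∀ v, Q ((T ^ i) v) = 0 :=
    ⟨m, fun i hi v => by rw [pow_zero_of_le (hmz v) hi, map_zero]⟩
  obtain ⟨l, hl, hlmin⟩ : ∃ l, (∀ i, l ≤ i → ∀ v, Q ((T ^ i) v) = 0) ∧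
      ∀ n, n < l → ¬ ∀ i, n ≤ i → ∀ v, Q ((T ^ i) v) = 0 :=
    ⟨Nat.find hex, Nat.find_spec hex, fun n hn => Nat.find_min hex hn⟩
  have hlm : l ≤ m := by
    by_contra! hc
    exact hlmin m hc fun i hi v => by rw [pow_zero_of_le (hmz v) hi, map_zero]
  have hml : m ≤ 2 * l := by
    by_contra! hc
    have h1 := hu (m - 1)
    rw [if_pos (by omega), show m - 1 = (l + (m - 1 - 2 * l)) + l by omega, ← h.adj_pow2,
      pow_add, Module.End.mul_apply] at h1
    have h2 := h.add ((T ^ l) ((T ^ (m - 1 - 2 * l)) u₁)) ((T ^ l) u₂)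
    rw [← map_add, hl l le_rfl, hl l le_rfl, hl l le_rfl, h1] at h2
    simp at h2
  have hl1 : 1 ≤ l := by omega
  obtain ⟨w, hw⟩ : ∃ w, Q ((T ^ (l - 1)) w) ≠ 0 := by
    by_contra! hc
    apply hlmin (l - 1) (by omega)
    intro i hi v
    rcases Nat.eq_or_lt_of_le hi with rfl | hi
    · exact hc v
    · exact hl i (by omega) v
  obtain ⟨c, hc⟩ := h.norm_Q hl1 hw (fun i hi => hl i hi w)
  set v₁ := ∑ j ∈ range l, c j • (T ^ j) w with hv₁
  have htop : (T ^ (m - 1)) v₁ ≠ 0 := by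
    intro h0
    obtain ⟨a, b, u, hab⟩ := S0_decomp (T := T) v₁ (by rw [hS]; trivial : v₁ ∈ S0 T u₁ u₂)
    have h1 : (T ^ (m - 1)) (T u) = 0 := by
      rw [← Module.End.mul_apply, ← pow_succ, show m - 1 + 1 = m by omega, hmz]
    have h2 : a • (T ^ (m - 1)) u₁ + b • (T ^ (m - 1)) u₂ = 0 := by
      rw [← h0, hab, map_add, map_add, h1, map_smul, map_smul, add_zero]
    have ha : a = 0 := by
      have := congrArg (fun x => B x u₂) h2
      simp only [map_add, map_smul, LinearMap.add_apply, LinearMap.smul_apply, hu, h.alt_pow] at this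
      rw [if_pos (by omega)] at this
      simpa using this
    have hb : b = 0 := by
      have := congrArg (fun x => B x u₁) h2
      have h21 := h.B21 hu (m - 1) 0
      rw [pow_zero, Module.End.one_apply, if_pos (by omega)] at h21
      simp only [map_add, map_smul, LinearMap.add_apply, LinearMap.smul_apply, h21, h.alt_pow] at this
      simpa using this
    have h3 := hc (l - 1)
    rw [if_pos (by omega), hab, ha, hb, zero_smul, zero_smul, zero_add, zero_add,
      ← Module.End.mul_apply, ← pow_succ, hl _ (by omega)] at h3
    exact zero_ne_one h3
  obtain ⟨y', hy'⟩ := hdual v₁ htop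
  obtain ⟨w₂, -, hw₂, -, -⟩ := h.split' hBQ hind hm1 hy' (hmz _) (hmz _)
  obtain ⟨r, n, ε, hε, hQ2, hB2, -⟩ := h.core δ hδ hml hc hw₂ (fun i hi => hl i hi w₂)
  refine ⟨m, l, ε, hm1, hε, hml, hlm, ?_⟩
  exact h.stdW hBQ hl1 hlm hB2 (hmz _) (hmz _)
    (h.split hBQ hind hm1 hB2 (hmz _) (hmz _)).1 hc hQ2

theorem defA (h : AuxFM B Q T) (hnil : IsNilpotent T) {z : V} (hz0 : z ≠ 0)
    (hrad : ∀ x, (∀ y, B x y = 0) → ∃ a : F, x = a • z)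
    (star : ∀ m, 1 ≤ m → ∀ u v, (T ^ m) u = 0 → (T ^ m) v = 0 → B ((T ^ (m - 1)) u) v = 0)
    (X : Submodule F V) (hzX : z ∈ X) (hX : ∀ x ∈ X, T x ∈ X)
    (hXp : ∀ x, ∃ y ∈ X, ∀ u ∈ X, B u (x - y) = 0) :
    ∃ k, (∀ x ∈ X, (T ^ (k + 1)) x = 0) ∧ (∀ x ∈ X, ∃ a : F, (T ^ k) x = a • z) ∧
      ∃ v ∈ X, (T ^ k) v = z := by
  classical
  have hXn : ∀ i, ∀ x ∈ X, (T ^ i) x ∈ X := by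
    intro i
    induction i with
    | zero => exact fun x hx => hx
    | succ n ih => intro x hx; rw [pow_succ', Module.End.mul_apply]; exact hX _ (ih x hx)
  have hex : ∃ n, ∀ x ∈ X, (T ^ n) x = 0 := by
    obtain ⟨n, hn⟩ := hnil
    exact ⟨n, fun x _ => by rw [hn]; rfl⟩
  obtain ⟨n, hn, hmin⟩ : ∃ n, (∀ x ∈ X, (T ^ n) x = 0) ∧ ∀ k, k < n → ¬ ∀ x ∈ X, (T ^ k) x = 0 :=
    ⟨Nat.find hex, Nat.find_spec hex, fun k hk => Nat.find_min hex hk⟩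
  rcases n with _ | k
  · exact absurd (by simpa using hn z hzX) hz0
  have hall : ∀ x ∈ X, ∃ a : F, (T ^ k) x = a • z := by
    intro x hx
    apply hrad
    intro y
    obtain ⟨y', hy', hp⟩ := hXp y
    have h1 := hp _ (hXn k x hx)
    rw [map_sub, sub_eq_zero] at h1
    rw [h1]
    exact star (k + 1) (by omega) x y' (hn x hx) (hn y' hy')
  refine ⟨k, hn, hall, ?_⟩
  have := hmin k (by omega)
  push Not at this
  obtain ⟨x, hx, hx0⟩ := this
  obtain ⟨a, ha⟩ := hall x hx
  have ha0 : a ≠ 0 := by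
    rintro rfl
    exact hx0 (by rw [ha, zero_smul])
  exact ⟨a⁻¹ • x, Submodule.smul_mem _ _ hx, by rw [map_smul, ha, inv_smul_smul₀ ha0]⟩

theorem defB (h : AuxFM B Q T) {z : V} (hz0 : z ≠ 0) (hTz : T z = 0)
    (hrad : ∀ x, (∀ y, B x y = 0) → ∃ a : F, x = a • z)
    (X : Submodule F V) (hX : ∀ x ∈ X, T x ∈ X)
    (hXp : ∀ x, ∃ y ∈ X, ∀ u ∈ X, B u (x - y) = 0) {k : ℕ} (hk : 1 ≤ k)
    (hall : ∀ x ∈ X, ∃ a : F, (T ^ k) x = a • z) {v₁ : V} (hv : v₁ ∈ X) (hv0 : (T ^ k) v₁ ≠ 0) :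
    ∃ v₂ ∈ X, (T ^ k) v₂ = 0 ∧ B ((T ^ (k - 1)) v₁) v₂ ≠ 0 := by
  have hXn : ∀ i, ∀ x ∈ X, (T ^ i) x ∈ X := by
    intro i
    induction i with
    | zero => exact fun x hx => hx
    | succ n ih => intro x hx; rw [pow_succ', Module.End.mul_apply]; exact hX _ (ih x hx)
  obtain ⟨a, ha⟩ := hall v₁ hv
  have ha0 : a ≠ 0 := by
    rintro rfl
    exact hv0 (by rw [ha, zero_smul])
  obtain ⟨y, hy⟩ : ∃ y, B ((T ^ (k - 1)) v₁) y ≠ 0 := by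
    by_contra! hc
    obtain ⟨b, hb⟩ := hrad _ hc
    apply hv0
    rw [show k = (k - 1) + 1 by omega, pow_succ', Module.End.mul_apply, hb, map_smul, hTz, smul_zero]
  obtain ⟨y', hy', hp⟩ := hXp y
  have h1 := hp _ (hXn (k - 1) v₁ hv)
  rw [map_sub, sub_eq_zero] at h1
  rw [h1] at hy
  obtain ⟨b, hb⟩ := hall y' hy'
  refine ⟨y' - (b * a⁻¹) • v₁, sub_mem hy' (Submodule.smul_mem _ _ hv), ?_, ?_⟩
  · rw [map_sub, map_smul, hb, ha, smul_smul, mul_assoc, inv_mul_cancel₀ ha0, mul_one, sub_self]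
  · rw [map_sub, map_smul, h.alt_pow, smul_zero, sub_zero]
    exact hy

/-- The defective case. -/
theorem defective [Fintype F] [CharP F 2] (h : AuxFM B Q T)
    (δ : F) (hδ : ∀ x : F, δ ≠ x + x ^ 2)
    (hBQ : ∀ x y, QuadraticMap.polar Q x y = B x y)
    (hind : Q.FormModuleIndecomposable T) (hnil : IsNilpotent T) {z : V} (hz0 : z ≠ 0)
    (hz : ∀ x, B z x = 0) (hQz : Q z ≠ 0)
    (hrad : ∀ x, (∀ y, B x y = 0) → ∃ a : F, x = a • z) :
    ∃ m : ℕ, 1 ≤ m ∧ Q.IsStandardD T m := by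
  have hTz : T z = 0 := by
    obtain ⟨a, ha⟩ := hrad (T z) (fun y => by rw [h.adj, hz])
    obtain ⟨n, hn⟩ := hnil
    have h1 : ∀ n, (T ^ n) z = a ^ n • z := by
      intro n
      induction n with
      | zero => simp
      | succ n ih => rw [pow_succ', Module.End.mul_apply, ih, map_smul, ha, smul_smul, pow_succ]
    have h2 := h1 n
    rw [hn, LinearMap.zero_apply] at h2
    have h3 := (smul_eq_zero.1 h2.symm).resolve_right hz0
    rw [ha, eq_zero_of_pow_eq_zero h3, zero_smul]
  have star : ∀ m, 1 ≤ m → ∀ u v, (T ^ m) u = 0 → (T ^ m) v = 0 →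
      B ((T ^ (m - 1)) u) v = 0 := by
    intro m hm u v hu hv
    by_contra hc
    obtain ⟨w, -, -, -, hw⟩ := h.split' hBQ hind hm hc hu hv
    exact hz0 (hw z fun s _ => by rw [h.symm, hz])
  have htopX : ∀ x : V, ∃ y ∈ (⊤ : Submodule F V), ∀ u ∈ (⊤ : Submodule F V), B u (x - y) = 0 :=
    fun x => ⟨x, trivial, fun u _ => by simp⟩
  obtain ⟨k, hk1, hall, v, -, hv⟩ := h.defA hnil hz0 hrad star ⊤ trivial (fun _ _ => trivial) htopX
  have hk1' : ∀ x, (T ^ (k + 1)) x = 0 := fun x => hk1 x trivial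
  obtain ⟨c, hc⟩ := h.norm_Q (v₁ := v) (l := k + 1) (by omega)
    (by rw [Nat.add_sub_cancel, hv]; exact hQz)
    (fun i hi => by rw [pow_zero_of_le (hk1' v) hi, map_zero])
  set v₁ := ∑ j ∈ range (k + 1), c j • (T ^ j) v with hv₁
  have hv₁0 : (T ^ k) v₁ ≠ 0 := by
    intro h0
    have := hc k
    rw [h0] at this
    simp at this
  obtain ⟨a, ha⟩ := hall v₁ trivial
  have ha0 : a ≠ 0 := by
    rintro rfl
    exact hv₁0 (by rw [ha, zero_smul])
  have hzv : z = a⁻¹ • (T ^ k) v₁ := by rw [ha, inv_smul_smul₀ ha0]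
  refine ⟨k + 1, by omega, ?_⟩
  rcases Nat.eq_zero_or_pos k with rfl | hkpos
  · apply h.stdD hBQ (v₁ := v₁) (v₂ := 0) (k := 0)
    · intro n; simp
    · exact hk1' _
    · simp
    · rw [eq_top_iff]
      intro x _
      obtain ⟨b, hb⟩ := hall x trivial
      rw [pow_zero, Module.End.one_apply] at hb
      rw [hb, hzv]
      exact Submodule.smul_mem _ _ (Submodule.smul_mem _ _ (mem1 _ _ _))
    · intro n; rw [hc]; simp
    · simp
  obtain ⟨w, -, hw, hw'⟩ := h.defB hz0 hTz hrad ⊤ (fun _ _ => trivial) htopX hkpos hall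
    (v₁ := v₁) trivial hv₁0
  obtain ⟨d, hd⟩ := h.norm_pair hkpos hw'
    (fun i hi => by rw [h.adj_pow, pow_zero_of_le hw hi, map_zero])
  set w₂ := ∑ j ∈ range k, d j • (T ^ j) w with hw₂
  have hw₂0 : (T ^ k) w₂ = 0 := poly_zero hw d k
  obtain ⟨r, n, ε, -, hQ2, hB2, hr0⟩ := h.core δ hδ (l := k + 1) (by omega) hc hd
    (fun i hi => by rw [pow_zero_of_le (hk1' _) hi, map_zero])
  have hr : r 0 = 0 := hr0 (by omega) (by rw [Nat.add_sub_cancel, hw₂0, map_zero])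
  set v₂ := w₂ + ∑ j ∈ range n, r j • (T ^ j) v₁ with hv₂
  have hv₂0 : (T ^ k) v₂ = 0 := by
    rw [hv₂, map_add, hw₂0, zero_add, pow_poly]
    apply sum_eq_zero
    intro j _
    rcases Nat.eq_zero_or_pos j with rfl | hj
    · rw [hr, zero_smul]
    · rw [pow_zero_of_le (hk1' _) (by omega), smul_zero]
  apply h.stdD hBQ hB2 (hk1' _) hv₂0
  · have hperp := h.proj_perp hB2 (fun x => by rw [ha, map_smul, LinearMap.smul_apply, hz, smul_zero])
      (by simp [hv₂0])
    set X := B.orthogonal (S0 T v₁ v₂) with hXdef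
    have hXmem : ∀ x, x ∈ X ↔ ∀ s ∈ S0 T v₁ v₂, B s x = 0 := fun x =>
      LinearMap.BilinForm.mem_orthogonal_iff
    have hXinv : ∀ x ∈ X, T x ∈ X := h.orth_inv S0_inv
    have hXp : ∀ x, ∃ y ∈ X, ∀ u ∈ X, B u (x - y) = 0 := by
      intro x
      refine ⟨x - proj B T v₁ v₂ k x, (hXmem _).2 (hperp x), fun u hu => ?_⟩
      rw [sub_sub_cancel, h.symm]
      exact (hXmem u).1 hu _ (proj_mem _ _ _ _)
    have hzX : z ∈ X := (hXmem z).2 fun s _ => by rw [h.symm, hz]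
    obtain ⟨k', -, hall', v', hv'X, hv'⟩ := h.defA hnil hz0 hrad star X hzX hXinv hXp
    have hkk : k' ≤ k := by
      by_contra! hlt
      exact hz0 (by rw [← hv', pow_zero_of_le (hk1' _) (by omega)])
    rcases Nat.eq_zero_or_pos k' with rfl | hk'
    · rw [eq_top_iff]
      intro x _
      obtain ⟨b, hb⟩ := hall' _ ((hXmem _).2 (hperp x))
      rw [pow_zero, Module.End.one_apply] at hb
      rw [← add_sub_cancel (proj B T v₁ v₂ k x) x, hb, hzv]
      exact add_mem (proj_mem _ _ _ _)
        (Submodule.smul_mem _ _ (Submodule.smul_mem _ _ (mem1 _ _ _)))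
    · exfalso
      obtain ⟨y, hyX, hy0, hy⟩ := h.defB hz0 hTz hrad X hXinv hXp hk' hall' hv'X
        (by rw [hv']; exact hz0)
      have h1 := star k' hk' ((T ^ (k - k')) v₁ - a • v') y
        (by rw [map_sub, map_smul, hv', ← Module.End.mul_apply, ← pow_add,
              show k' + (k - k') = k by omega, ha, sub_self]) hy0
      rw [map_sub, map_smul, ← Module.End.mul_apply, ← pow_add, map_sub, LinearMap.sub_apply,
        (hXmem y).1 hyX _ (mem1 _ _ _), map_smul, LinearMap.smul_apply, zero_sub, neg_eq_zero,
        smul_eq_mul] at h1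
      exact hy ((mul_eq_zero.1 h1).resolve_left ha0)
  · intro i
    rw [hc]; simp
  · intro i
    rw [hQ2, if_neg (by omega)]

end AuxFM

end Aux

/-- Classification of non-degenerate indecomposable form modules over a finite field `F` of
characteristic 2: fixing `δ ∈ F` with `δ ∉ {x + x² | x ∈ F}`, every such module is isomorphic
to some `W_l^0(m)` with `⌊(m+1)/2⌋ ≤ l ≤ m`, some `W_l^δ(m)` with `(m+1)/2 ≤ l ≤ m`,
or some `D(m)`. -/
theorem indecomposable_form_module_classification
    (F : Type*) [Field F] [Fintype F] [CharP F 2]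
    (δ : F) (hδ : ∀ x : F, δ ≠ x + x ^ 2)
    (V : Type*) [AddCommGroup V] [Module F V] [FiniteDimensional F V]
    (Q : QuadraticForm F V) (T : Module.End F V)
    (hQ : Q.IsNondegenerateFormSpace) (hT : Q.mem_oLie T) (hTnil : IsNilpotent T)
    (hind : Q.FormModuleIndecomposable T) :
    (∃ m l : ℕ, 1 ≤ m ∧ (m + 1) / 2 ≤ l ∧ l ≤ m ∧ Q.IsStandardW T 0 l m) ∨
    (∃ m l : ℕ, 1 ≤ m ∧ m + 1 ≤ 2 * l ∧ l ≤ m ∧ Q.IsStandardW T δ l m) ∨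
    (∃ m : ℕ, 1 ≤ m ∧ Q.IsStandardD T m) := by
  have hBQ : ∀ x y, QuadraticMap.polar Q x y = QuadraticMap.polarBilin Q x y := fun x y => rfl
  have hadd : ∀ x y, Q (x + y) = Q x + Q y + QuadraticMap.polarBilin Q x y := fun x y =>
    QuadraticMap.map_add Q x y
  have hsymm : ∀ x y, QuadraticMap.polarBilin Q x y = QuadraticMap.polarBilin Q y x :=
    fun x y => QuadraticMap.polar_comm Q x y
  have haltT : ∀ x, QuadraticMap.polarBilin Q (T x) x = 0 := hT.1
  have h : AuxFM (QuadraticMap.polarBilin Q) Q T :=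
    { symm := hsymm
      adj := by
        intro x y
        have h1 := haltT (x + y)
        simp only [map_add, LinearMap.add_apply, haltT, zero_add, add_zero] at h1
        rw [hsymm x (T y)]
        exact (CharTwo.add_eq_zero.1 h1).symm
      alt := by
        intro x
        rw [← hBQ, QuadraticMap.polar_self, two_smul]
        exact CharTwo.add_self_eq_zero _
      altT := haltT
      add := hadd }
  obtain ⟨hnt, hfr, hQne⟩ := hQ
  have hmem : ∀ x, x ∈ Q.polarRadical ↔ ∀ y, QuadraticMap.polarBilin Q x y = 0 := by
    intro x
    rw [QuadraticForm.polarRadical, LinearMap.mem_ker, LinearMap.ext_iff]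
    rfl
  by_cases hbot : ∃ z ∈ Q.polarRadical, z ≠ 0
  · obtain ⟨z, hz, hz0⟩ := hbot
    right; right
    refine h.defective δ hδ hBQ hind hTnil hz0 ((hmem z).1 hz) (hQne z hz hz0) ?_
    intro x hx
    have hx' := (hmem x).2 hx
    have hf1 : Module.finrank F Q.polarRadical = 1 := by
      apply le_antisymm hfr
      have : Nontrivial Q.polarRadical := ⟨⟨⟨z, hz⟩, 0, fun hh => hz0 (congrArg Subtype.val hh)⟩⟩
      exact Module.finrank_pos
    obtain ⟨c, hc⟩ := (finrank_eq_one_iff_of_nonzero' (⟨z, hz⟩ : Q.polarRadical)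
      (fun hh => hz0 (congrArg Subtype.val hh))).1 hf1 ⟨x, hx'⟩
    exact ⟨c, (congrArg Subtype.val hc).symm⟩
  · push Not at hbot
    obtain ⟨m, l, ε, hm, hε, hml, hlm, hW⟩ := h.nondef δ hδ hBQ hind hTnil
      (fun x hx => hbot x ((hmem x).2 hx))
    rcases hε with rfl | ⟨rfl, h2⟩
    · exact Or.inl ⟨m, l, hm, by omega, hlm, hW⟩
    · exact Or.inr (Or.inl ⟨m, l, hm, h2, hlm, hW⟩)
end
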